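/- Let d ≥ 1, m > 1, m* = m/(m−1), and suppose (b,V) satisfies hypothesis (H1) with parameters δ = 0, ρ > 0, a ∈ ℝ, η > 0, R > 0, with η > 1 and a < d − 1. Then liminf_{β→∞} β^{1/(η−1)} (ρ^{m*}/m* − λ_max(β)) ≥ c₁, where c₁ := (η−1) · (ρ^{m*−1}(d−1−a)/η)^{η/(η−1)}. -/

import Mathlib

open Filter Real RealInnerProductSpace

noncomputable section

abbrev Euc (d : ℕ) := EuclideanSpace ℝ (Fin d)

/-- The Laplacian of `φ`, defined as the sum of the second partial derivatives
in the coordinate directions. -/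
def lap {d : ℕ} (φ : Euc d → ℝ) (x : Euc d) : ℝ :=
  ∑ i : Fin d, fderiv ℝ (fun y => fderiv ℝ φ y (EuclideanSpace.single i 1)) x
    (EuclideanSpace.single i 1)

/-- `(lam, φ)` is a subsolution of the ergodic problem (EP). -/
def IsSubsol {d : ℕ} (m : ℝ) (b : Euc d → Euc d) (V : Euc d → ℝ) (β lam : ℝ)
    (φ : Euc d → ℝ) : Prop :=
  ContDiff ℝ 3 φ ∧ ∀ x : Euc d,
    lam - lap φ x + ⟪b x, gradient φ x⟫ + (1 / m) * ‖gradient φ x‖ ^ m - β * V x ≤ 0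

/-- The generalized principal eigenvalue `λ_max(β)`. -/
def lamMax {d : ℕ} (m : ℝ) (b : Euc d → Euc d) (V : Euc d → ℝ) (β : ℝ) : ℝ :=
  sSup {lam : ℝ | ∃ φ : Euc d → ℝ, IsSubsol m b V β lam φ}

/-- Hypothesis (H0) with parameter `δ` and constants `ρ, R` and auxiliary function `α`. -/
def HypH0 {d : ℕ} (δ ρ R : ℝ) (b : Euc d → Euc d) (V : Euc d → ℝ) (α : Euc d → ℝ) : Prop :=
  ContDiff ℝ 2 b ∧ ContDiff ℝ 2 V ∧ (∃ M : ℝ, ∀ x : Euc d, ‖gradient V x‖ ≤ M) ∧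
  ContDiff ℝ 2 α ∧
  (∀ x : Euc d, R ≤ ‖x‖ → b x = ((ρ + α x) * ‖x‖ ^ (δ - 1)) • x) ∧
  Tendsto α (cocompact (Euc d)) (nhds 0) ∧
  (∀ x : Euc d, 0 ≤ V x) ∧
  Metric.closedBall (0 : Euc d) R ⊆ interior (Function.support V) ∧
  Tendsto V (cocompact (Euc d)) (nhds 0)

/-- Hypothesis (H1): (H0) together with `α(x) = a|x|⁻¹` and `V(x) = |x|^{-η}` outside `B_R`. -/
def HypH1 {d : ℕ} (δ ρ R a η : ℝ) (b : Euc d → Euc d) (V : Euc d → ℝ) (α : Euc d → ℝ) : Prop :=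
  HypH0 δ ρ R b V α ∧
  ∀ x : Euc d, R ≤ ‖x‖ → α x = a * ‖x‖⁻¹ ∧ V x = ‖x‖ ^ (-η)



open MeasureTheory

lemma hasGradientAt_norm' {d : ℕ} {x : Euc d} (hx : x ≠ 0) :
    HasGradientAt (fun y : Euc d => ‖y‖) (‖x‖⁻¹ • x) x := by
  rw [hasGradientAt_iff_hasFDerivAt]
  have hn : ‖x‖ ≠ 0 := norm_ne_zero_iff.2 hx
  have h := (hasStrictFDerivAt_norm_sq x).hasFDerivAt.sqrt (pow_ne_zero 2 hn)
  have e : (fun y : Euc d => √(‖y‖ ^ 2)) = fun y => ‖y‖ := by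
    funext y; exact Real.sqrt_sq (norm_nonneg y)
  rw [e] at h
  refine h.congr_fderiv ?_
  ext v
  simp [Real.sqrt_sq (norm_nonneg x)]
  field_simp

lemma integral_by_parts' {d : ℕ} {φ μ : Euc d → ℝ} (hφ : ContDiff ℝ 3 φ) (hμ : ContDiff ℝ 1 μ)
    (hc : HasCompactSupport μ) :
    Integrable (fun x => μ x * lap φ x + ⟪gradient φ x, gradient μ x⟫) ∧
    ∫ x, (μ x * lap φ x + ⟪gradient φ x, gradient μ x⟫) = 0 := by
  have hφ1 : ContDiff ℝ 2 (fderiv ℝ φ) := hφ.fderiv_right (by norm_num)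
  have hμ1 : Continuous (fderiv ℝ μ) := hμ.continuous_fderiv (by norm_num)
  have hφi : ∀ i : Fin d, ContDiff ℝ 2 (fun y => fderiv ℝ φ y (EuclideanSpace.single i 1)) :=
    fun i => hφ1.clm_apply contDiff_const
  have hφii : ∀ i : Fin d, Continuous (fun x => fderiv ℝ (fun y => fderiv ℝ φ y (EuclideanSpace.single i 1)) x
    (EuclideanSpace.single i 1)) := fun i =>
      ((hφi i).continuous_fderiv (by norm_num)).clm_apply continuous_const
  have hi1 : ∀ i : Fin d, Integrable (fun x => μ x * fderiv ℝ (fun y => fderiv ℝ φ y (EuclideanSpace.single i 1)) x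
    (EuclideanSpace.single i 1)) := fun i =>
    (hμ.continuous.mul (hφii i)).integrable_of_hasCompactSupport hc.mul_right
  have hi2 : ∀ i : Fin d, Integrable (fun x => fderiv ℝ μ x (EuclideanSpace.single i 1) *
      fderiv ℝ φ x (EuclideanSpace.single i 1)) := fun i =>
    ((hμ1.clm_apply continuous_const).mul (hφi i).continuous).integrable_of_hasCompactSupport
      (HasCompactSupport.mul_right (hc.fderiv_apply ℝ _))
  have key : ∀ x, μ x * lap φ x + ⟪gradient φ x, gradient μ x⟫ =
      ∑ i : Fin d, (μ x * fderiv ℝ (fun y => fderiv ℝ φ y (EuclideanSpace.single i 1)) x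
        (EuclideanSpace.single i 1) + fderiv ℝ μ x (EuclideanSpace.single i 1) *
      fderiv ℝ φ x (EuclideanSpace.single i 1)) := by
    intro x
    rw [lap, Finset.mul_sum, Finset.sum_add_distrib]
    congr 1
    rw [PiLp.inner_apply]
    refine Finset.sum_congr rfl fun i _ => ?_
    rw [← inner_gradient_left, ← inner_gradient_left]
    rw [EuclideanSpace.inner_single_right, EuclideanSpace.inner_single_right]
    simp [mul_comm]
  have hi3 : ∀ i : Fin d, Integrable (fun x =>
      (μ x * fderiv ℝ (fun y => fderiv ℝ φ y (EuclideanSpace.single i 1)) x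
        (EuclideanSpace.single i 1) + fderiv ℝ μ x (EuclideanSpace.single i 1) *
      fderiv ℝ φ x (EuclideanSpace.single i 1))) := fun i => (hi1 i).add (hi2 i)
  simp_rw [key]
  refine ⟨integrable_finsetSum _ fun i _ => hi3 i, ?_⟩
  rw [integral_finsetSum _ fun i _ => hi3 i]
  refine Finset.sum_eq_zero fun i _ => ?_
  rw [integral_add (hi1 i) (hi2 i), integral_mul_fderiv_eq_neg_fderiv_mul_of_integrable (hi2 i) (hi1 i)
    ((hμ.continuous.mul (hφi i).continuous).integrable_of_hasCompactSupport hc.mul_right)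
    (fun x _ => hμ.differentiable (by norm_num) x) (fun x _ => (hφi i).differentiable (by norm_num) x)]
  simp

lemma young' {d : ℕ} {m q : ℝ} (h : m.HolderConjugate q) (p g b : Euc d) {u : ℝ} (hu : 0 < u) :
    - ⟪p, g⟫ - u * ⟪b, p⟫ - u * ((1 / m) * ‖p‖ ^ m) ≤ u * (‖b + u⁻¹ • g‖ ^ q / q) := by
  have h1 := Real.young_inequality_of_nonneg (norm_nonneg p) (norm_nonneg (b + u⁻¹ • g)) h
  have h2 : -⟪b + u⁻¹ • g, p⟫ ≤ ‖p‖ * ‖b + u⁻¹ • g‖ := by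
    have := abs_real_inner_le_norm (b + u⁻¹ • g) p
    have := neg_abs_le ⟪b + u⁻¹ • g, p⟫
    linarith [mul_comm ‖p‖ ‖b + u⁻¹ • g‖]
  rw [inner_add_left, inner_smul_left, real_inner_comm p g] at h2
  have h3 := mul_le_mul_of_nonneg_left (h2.trans h1) hu.le
  simp only [conj_trivial] at h3
  have : u * -(⟪b, p⟫ + u⁻¹ * ⟪p, g⟫) = -⟪p, g⟫ - u * ⟪b, p⟫ := by field_simp; ring
  rw [this] at h3
  have : u * (‖p‖ ^ m / m + ‖b + u⁻¹ • g‖ ^ q / q) = u * ((1 / m) * ‖p‖ ^ m) + u * (‖b + u⁻¹ • g‖ ^ q / q) := by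
    ring
  linarith

lemma taylor' {ρ q ε : ℝ} (hρ : 0 < ρ) (hq : 1 < q) (hε : 0 < ε) :
    ∃ C : ℝ, 0 ≤ C ∧ ∀ s : ℝ, |ρ + s| ^ q / q ≤ ρ ^ q / q + ρ ^ (q - 1) * s + ε * |s| + C * |s| ^ q := by
  have hq0 : 0 < q := by linarith
  have hd : HasDerivAt (fun x : ℝ => x ^ q / q) (ρ ^ (q - 1)) ρ := by
    have := (Real.hasDerivAt_rpow_const (x := ρ) (p := q) (Or.inl hρ.ne')).div_const q
    rwa [mul_div_cancel_left₀ _ hq0.ne'] at this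
  rw [hasDerivAt_iff_isLittleO_nhds_zero] at hd
  have h1 := hd.def hε
  obtain ⟨δ, hδ, hδ'⟩ := Metric.eventually_nhds_iff.1 h1
  set δ' := min δ ρ
  have hδ'0 : 0 < δ' := lt_min hδ hρ
  refine ⟨(ρ / δ' + 1) ^ q / q + ρ ^ (q - 1) * δ' ^ (1 - q), by positivity, fun s => ?_⟩
  rcases lt_or_ge |s| δ' with hs | hs
  · have h2 := hδ' (y := s) (by simpa using lt_of_lt_of_le hs (min_le_left _ _))
    have h3 := lt_of_lt_of_le hs (min_le_right _ _)
    rw [abs_lt] at h3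
    rw [abs_of_pos (by linarith : 0 < ρ + s)]
    have h4 := (abs_le.1 h2).2
    simp only [smul_eq_mul, Real.norm_eq_abs] at h4
    have : 0 ≤ ((ρ / δ' + 1) ^ q / q + ρ ^ (q - 1) * δ' ^ (1 - q)) * |s| ^ q := by positivity
    linarith [mul_comm s (ρ ^ (q - 1))]
  · have hs0 : 0 < |s| := lt_of_lt_of_le hδ'0 hs
    have a1 : |ρ + s| ≤ (ρ / δ' + 1) * |s| := by
      have : ρ ≤ ρ / δ' * |s| := by
        rw [div_mul_eq_mul_div, le_div_iff₀ hδ'0]; gcongr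
      calc |ρ + s| ≤ |ρ| + |s| := abs_add_le _ _
        _ ≤ _ := by rw [abs_of_pos hρ]; linarith
    have a2 : |ρ + s| ^ q / q ≤ (ρ / δ' + 1) ^ q / q * |s| ^ q := by
      have : |ρ + s| ^ q ≤ ((ρ / δ' + 1) * |s|) ^ q := by gcongr
      rw [Real.mul_rpow (by positivity) hs0.le] at this
      rw [div_mul_eq_mul_div]; gcongr
    have a3 : |s| ≤ δ' ^ (1 - q) * |s| ^ q := by
      have : |s| ^ (1 - q) ≤ δ' ^ (1 - q) := Real.rpow_le_rpow_of_nonpos hδ'0 hs (by linarith)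
      calc |s| = |s| ^ (1 - q) * |s| ^ q := by rw [← Real.rpow_add hs0]; simp
        _ ≤ _ := by gcongr
    have a4 : -(ρ ^ (q - 1) * s) ≤ ρ ^ (q - 1) * (δ' ^ (1 - q) * |s| ^ q) := by
      have : ρ ^ (q - 1) * (-s) ≤ ρ ^ (q - 1) * (δ' ^ (1 - q) * |s| ^ q) := by
        gcongr; exact (neg_le_abs s).trans a3
      linarith
    have : 0 < ρ ^ q / q := by positivity
    have : 0 ≤ ε * |s| := by positivity
    linarith

lemma lap_continuous' {d : ℕ} {φ : Euc d → ℝ} (hφ : ContDiff ℝ 3 φ) : Continuous (lap φ) := by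
  have hφ1 : ContDiff ℝ 2 (fderiv ℝ φ) := hφ.fderiv_right (by norm_num)
  have hφi : ∀ i : Fin d, ContDiff ℝ 2 (fun y => fderiv ℝ φ y (EuclideanSpace.single i 1)) :=
    fun i => hφ1.clm_apply contDiff_const
  unfold lap
  exact continuous_finsetSum _ fun i _ =>
      ((hφi i).continuous_fderiv (by norm_num)).clm_apply continuous_const

lemma gradient_continuous' {d : ℕ} {φ : Euc d → ℝ} (hφ : ContDiff ℝ 1 φ) :
    Continuous (gradient φ) := by
  unfold gradient
  exact (LinearIsometryEquiv.continuous _).comp (hφ.continuous_fderiv (by norm_num))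

lemma lap_radial' {d : ℕ} {φ : Euc d → ℝ} {k : ℝ} {x : Euc d} (hx : x ≠ 0)
    (h : ∀ᶠ y in nhds x, HasGradientAt φ ((k * ‖y‖⁻¹) • y) y) :
    lap φ x = k * (((d : ℝ) - 1) / ‖x‖) := by
  have hn : ‖x‖ ≠ 0 := norm_ne_zero_iff.2 hx
  have key : ∀ i : Fin d, fderiv ℝ (fun y => fderiv ℝ φ y (EuclideanSpace.single i 1)) x
      (EuclideanSpace.single i 1) = k * (‖x‖⁻¹ - x i ^ 2 / ‖x‖ ^ 3) := by
    intro i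
    have e : (fun y => fderiv ℝ φ y (EuclideanSpace.single i 1)) =ᶠ[nhds x]
        fun y => (k * ‖y‖⁻¹) * (EuclideanSpace.proj (𝕜 := ℝ) i y) := by
      filter_upwards [h] with y hy
      rw [hy.fderiv_apply, inner_smul_left, EuclideanSpace.inner_single_right]
      simp
    rw [e.fderiv_eq]
    have h1 := (hasGradientAt_iff_hasFDerivAt.1 (hasGradientAt_norm' hx))
    have h2 := (((hasDerivAt_inv hn).comp_hasFDerivAt x h1).const_mul k).mul
      (EuclideanSpace.proj (𝕜 := ℝ) i : Euc d →L[ℝ] ℝ).hasFDerivAt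
    have h3 : fderiv ℝ (fun y : Euc d => (k * ‖y‖⁻¹) * (EuclideanSpace.proj (𝕜 := ℝ) i y)) x = _ := h2.fderiv
    rw [h3]
    simp [EuclideanSpace.inner_single_right]
    field_simp
    ring
  unfold lap
  rw [Finset.sum_congr rfl fun i _ => key i, ← Finset.mul_sum, Finset.sum_sub_distrib, ← Finset.sum_div]
  have : ∑ i : Fin d, x i ^ 2 = ‖x‖ ^ 2 := (EuclideanSpace.real_norm_sq_eq x).symm
  rw [this]
  simp
  left
  field_simp

lemma exists_radial' (d : ℕ) {R : ℝ} (hR : 0 < R) (k : ℝ) : ∃ φ : Euc d → ℝ, ContDiff ℝ 3 φ ∧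
    ∀ x : Euc d, R ≤ ‖x‖ → HasGradientAt φ ((k * ‖x‖⁻¹) • x) x ∧ lap φ x = k * (((d : ℝ) - 1) / ‖x‖) := by
  set χ : Euc d → ℝ := fun x => smoothTransition ((16 * ‖x‖ ^ 2 / R ^ 2 - 1) / 3) with hχ
  have hχs : ContDiff ℝ 3 χ := by
    have : ContDiff ℝ 3 smoothTransition := smoothTransition.contDiff (n := 3)
    refine this.comp ?_
    exact (((contDiff_const.mul (contDiff_norm_sq ℝ)).div_const _).sub contDiff_const).div_const _
  have hgrad : ∀ x : Euc d, R / 2 < ‖x‖ →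
      HasGradientAt (fun x => k * (‖x‖ * χ x)) ((k * ‖x‖⁻¹) • x) x := by
    intro x hx
    have hx0 : x ≠ 0 := norm_pos_iff.1 (by linarith)
    have e : (fun x => k * (‖x‖ * χ x)) =ᶠ[nhds x] fun x => k * ‖x‖ := by
      filter_upwards [continuous_norm.continuousAt.eventually (lt_mem_nhds hx)] with y hy
      have : χ y = 1 := by
        apply smoothTransition.one_of_one_le
        rw [le_div_iff₀ (by norm_num), le_sub_iff_add_le, le_div_iff₀ (by positivity)]
        nlinarith
      rw [this, mul_one]
    refine HasGradientAt.congr_of_eventuallyEq ?_ e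
    rw [hasGradientAt_iff_hasFDerivAt]
    refine ((hasGradientAt_iff_hasFDerivAt.1 (hasGradientAt_norm' hx0)).const_mul k).congr_fderiv ?_
    ext v
    simp [mul_assoc]
  refine ⟨fun x => k * (‖x‖ * χ x), ?_, ?_⟩
  · refine contDiff_const.mul ?_
    rw [contDiff_iff_contDiffAt]
    intro x
    by_cases hx : x = 0
    · subst hx
      have e : (fun x : Euc d => ‖x‖ * χ x) =ᶠ[nhds 0] fun _ => 0 := by
        filter_upwards [Metric.ball_mem_nhds (0 : Euc d) (by positivity : 0 < R / 4)] with y hy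
        rw [mem_ball_zero_iff] at hy
        have : χ y = 0 := by
          apply smoothTransition.zero_of_nonpos
          apply div_nonpos_of_nonpos_of_nonneg _ (by norm_num)
          rw [sub_nonpos, div_le_iff₀ (by positivity)]
          nlinarith [norm_nonneg y]
        rw [this, mul_zero]
      exact contDiffAt_const.congr_of_eventuallyEq e
    · exact (contDiffAt_norm ℝ hx).mul hχs.contDiffAt
  · intro x hx
    refine ⟨hgrad x (by linarith), lap_radial' (norm_pos_iff.1 (by linarith)) ?_⟩
    filter_upwards [continuous_norm.continuousAt.eventually (lt_mem_nhds (show R / 2 < ‖x‖ by linarith))] with y hy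
    exact hgrad y hy

lemma scalar_bound' {A η : ℝ} (hA : 0 < A) (hη : 1 < η) : ∃ C : ℝ, 0 ≤ C ∧ ∀ β r : ℝ, 0 < β → 0 < r →
    A / r - β * r ^ (-η) ≤ C * β ^ (-(1 / (η - 1))) := by
  have h1 : 0 < η - 1 := by linarith
  refine ⟨A / (1 / A) ^ (1 / (η - 1)), by positivity, fun β r hβ hr => ?_⟩
  rcases le_total r ((β / A) ^ (1 / (η - 1))) with h | h
  · have h2 : r ^ (η - 1) ≤ β / A := by
      calc r ^ (η - 1) ≤ ((β / A) ^ (1 / (η - 1))) ^ (η - 1) := by gcongr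
        _ = β / A := by rw [← Real.rpow_mul (by positivity), one_div_mul_cancel h1.ne', Real.rpow_one]
    have h3 : A / r ≤ β * r ^ (-η) := by
      have : r ^ (-η) = (r ^ (η - 1))⁻¹ * r⁻¹ := by
        rw [← Real.rpow_neg hr.le, ← Real.rpow_neg_one r, ← Real.rpow_add hr]; congr 1; ring
      rw [this]
      have hp : 0 < r ^ (η - 1) := by positivity
      rw [le_div_iff₀ hA] at h2
      rw [← mul_assoc, div_eq_mul_inv]
      gcongr
      rw [← div_eq_mul_inv, le_div_iff₀ hp]; linarith
    have : 0 ≤ A / (1 / A) ^ (1 / (η - 1)) * β ^ (-(1 / (η - 1))) := by positivity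
    linarith
  · have h2 : A / r ≤ A / (β / A) ^ (1 / (η - 1)) := by gcongr
    have h3 : A / (1 / A) ^ (1 / (η - 1)) * β ^ (-(1 / (η - 1))) = A / (β / A) ^ (1 / (η - 1)) := by
      rw [Real.rpow_neg hβ.le, show β / A = (1 / A) * β by ring, Real.mul_rpow (by positivity) hβ.le]
      field_simp
    have : 0 ≤ β * r ^ (-η) := by positivity
    linarith

lemma exists_subsol' {d : ℕ} {m ρ R a η q : ℝ} (hq : m.HolderConjugate q) (hρ : 0 < ρ) (hR : 0 < R)
    {b : Euc d → Euc d} {V α : Euc d → ℝ} (hH1 : HypH1 0 ρ R a η b V α) (hη : 1 < η)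
    (ha : a < (d : ℝ) - 1) :
    ∃ C : ℝ, ∀ᶠ β : ℝ in atTop, ∃ φ, IsSubsol m b V β (ρ ^ q / q - C * β ^ (-(1 / (η - 1)))) φ := by
  obtain ⟨⟨hb, hV, -, -, hbx, -, hV0, hsupp, -⟩, hH⟩ := hH1
  set κ := ρ ^ (q - 1) with hκ
  have hκ0 : 0 < κ := by positivity
  obtain ⟨C, hC0, hC⟩ := scalar_bound' (A := κ * ((d : ℝ) - 1 - a)) (mul_pos hκ0 (by linarith)) hη
  obtain ⟨φ, hφ, hφx⟩ := exists_radial' d hR (-κ)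
  have hφ1 : ContDiff ℝ 1 φ := hφ.of_le (by norm_num)
  have hm0 : 0 < m := hq.pos
  have hcont : Continuous fun x => ρ ^ q / q - lap φ x + ⟪b x, gradient φ x⟫ + (1 / m) * ‖gradient φ x‖ ^ m := by
    have := gradient_continuous' hφ1
    exact ((continuous_const.sub (lap_continuous' hφ)).add (hb.continuous.inner this)).add
      (continuous_const.mul (this.norm.rpow_const fun _ => Or.inr hm0.le))
  obtain ⟨M, hM⟩ := (isCompact_closedBall (0 : Euc d) R).bddAbove_image hcont.continuousOn
  obtain ⟨x0, hx0, hx0'⟩ := (isCompact_closedBall (0 : Euc d) R).exists_isMinOn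
    ⟨0, Metric.mem_closedBall_self hR.le⟩ hV.continuous.continuousOn
  have hv : 0 < V x0 := lt_of_le_of_ne (hV0 _) (Ne.symm (interior_subset (hsupp hx0)))
  refine ⟨C, ?_⟩
  filter_upwards [eventually_ge_atTop (M / V x0), eventually_gt_atTop 0] with β hβ hβ0
  refine ⟨φ, hφ, fun x => ?_⟩
  have hCβ : 0 ≤ C * β ^ (-(1 / (η - 1))) := by positivity
  rcases lt_or_ge ‖x‖ R with hx | hx
  · have hxm : x ∈ Metric.closedBall (0 : Euc d) R := by simpa using hx.le
    have h1 : _ ≤ M := hM ⟨x, hxm, rfl⟩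
    have h2 : V x0 ≤ V x := hx0' hxm
    rw [div_le_iff₀ hv] at hβ
    have : β * V x0 ≤ β * V x := by gcongr
    linarith
  · obtain ⟨hg, hl⟩ := hφx x hx
    obtain ⟨hα, hVx⟩ := hH x hx
    have hr : 0 < ‖x‖ := by linarith
    have hin : ⟪b x, gradient φ x⟫ = - κ * (ρ + a * ‖x‖⁻¹) := by
      rw [hg.gradient, hbx x hx, hα, inner_smul_left, inner_smul_right, real_inner_self_eq_norm_sq]
      rw [show (0 : ℝ) - 1 = -1 by norm_num, Real.rpow_neg_one]
      simp only [conj_trivial]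
      field_simp
    have hnorm : ‖gradient φ x‖ = κ := by
      rw [hg.gradient, norm_smul]
      simp only [norm_mul, norm_neg, norm_inv, norm_norm]
      rw [Real.norm_of_nonneg hκ0.le]; field_simp
    have hκm : κ ^ m = ρ ^ q := by
      rw [hκ, ← Real.rpow_mul hρ.le]; congr 1
      have := hq.symm.sub_one_mul_conj; linarith
    have hκρ : κ * ρ = ρ ^ q := by
      rw [hκ, ← Real.rpow_add_one hρ.ne']; congr 1; ring
    rw [hin, hnorm, hl, hκm, hVx]
    have h3 := hC β ‖x‖ hβ0 hr
    have h4 : ρ ^ q / q + (1 / m) * ρ ^ q = ρ ^ q := by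
      have := hq.inv_add_inv_eq_one
      rw [div_eq_mul_inv, one_div]
      linear_combination (ρ ^ q) * this
    have h5 : -(-κ * (((d : ℝ) - 1) / ‖x‖)) + -κ * (ρ + a * ‖x‖⁻¹) = κ * ((d : ℝ) - 1 - a) / ‖x‖ - κ * ρ := by
      field_simp; ring
    linarith
lemma profile' {τ q : ℝ} (hτ : 0 < τ) (hq : 1 < q) : ∃ G E : ℝ → ℝ, ContDiff ℝ 1 G ∧ (∀ t, 0 ≤ G t) ∧
    (∀ t, τ ≤ |t - 1| → G t = 0) ∧ 0 < G 1 ∧ Continuous E ∧ (∀ t, 0 ≤ E t) ∧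
    (∀ t, τ ≤ |t - 1| → E t = 0) ∧ (∀ t, G t = 0 → deriv G t = 0) ∧
    ∀ t, 0 < G t → G t * |deriv G t / G t| ^ q ≤ E t := by
  let f : ContDiffBump (1 : ℝ) := ⟨τ / 2, τ, by positivity, by linarith⟩
  obtain ⟨K, hK⟩ := exists_nat_gt q
  have hK0 : K ≠ 0 := by rintro rfl; norm_num at hK; linarith
  have hfs : ContDiff ℝ 1 f := f.contDiff
  have hfd : Differentiable ℝ f := hfs.differentiable (by norm_num)
  have hf0 : ∀ t, τ ≤ |t - 1| → f t = 0 := fun t ht => f.zero_of_le_dist (by rw [Real.dist_eq]; exact ht)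
  have hder : ∀ t, deriv (fun t => f t ^ K) t = K * f t ^ (K - 1) * deriv f t := fun t =>
    ((hfd t).hasDerivAt.pow K).deriv
  refine ⟨fun t => f t ^ K, fun t => (K : ℝ) ^ q * (f t ^ ((K : ℝ) - q) * |deriv f t| ^ q), hfs.pow K,
    fun t => pow_nonneg f.nonneg _, fun t ht => ?_, ?_, ?_, fun t => ?_, fun t ht => ?_, fun t ht => ?_,
    fun t ht => ?_⟩
  · simp only [hf0 t ht]; exact zero_pow hK0
  · have : f 1 = 1 := f.one_of_mem_closedBall (by simp [f]; positivity)
    simp [this]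
  · refine continuous_const.mul ((f.continuous.rpow_const fun _ => Or.inr (by linarith)).mul ?_)
    exact (hfs.continuous_deriv (by norm_num)).abs.rpow_const fun _ => Or.inr (by linarith)
  · have := f.nonneg' t
    positivity
  · simp only [hf0 t ht]; rw [Real.zero_rpow (by linarith)]; simp
  · refine IsLocalMin.deriv_eq_zero (Eventually.of_forall fun s => ?_)
    simp only at ht
    simp only [ht]
    exact pow_nonneg f.nonneg _
  · have h0 : 0 < f t := by
      refine lt_of_le_of_ne f.nonneg fun h => ?_
      simp only [← h, zero_pow hK0] at ht
      exact lt_irrefl _ ht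
    rw [hder]
    have e : (K : ℝ) * f t ^ (K - 1) * deriv f t / f t ^ K = K * (deriv f t / f t) := by
      obtain ⟨n, rfl⟩ := Nat.exists_eq_succ_of_ne_zero hK0
      rw [Nat.succ_sub_one]
      field_simp
      rw [pow_succ]; ring
    show f t ^ K * _ ≤ (K : ℝ) ^ q * (f t ^ ((K : ℝ) - q) * |deriv f t| ^ q)
    rw [e, abs_mul, abs_div, abs_of_pos h0, Nat.abs_cast, Real.mul_rpow (by positivity) (by positivity),
      Real.div_rpow (by positivity) h0.le, Real.rpow_sub h0, Real.rpow_natCast]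
    apply le_of_eq
    field_simp

lemma radial_cs' {d : ℕ} {h : ℝ → ℝ} (h0 : ∀ t, 2 ≤ t → h t = 0) {r : ℝ} (hr : 0 < r) :
    HasCompactSupport (fun x : Euc d => h (‖x‖ / r)) := by
  refine HasCompactSupport.intro (isCompact_closedBall (0 : Euc d) (2 * r)) fun x hx => h0 _ ?_
  rw [le_div_iff₀ hr]
  simp at hx
  exact hx.le

lemma radial_int' {d : ℕ} {h : ℝ → ℝ} (hc : Continuous h) (h0 : ∀ t, 2 ≤ t → h t = 0) {r : ℝ} (hr : 0 < r) :
    Integrable (fun x : Euc d => h (‖x‖ / r)) :=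
  (hc.comp (continuous_norm.div_const r)).integrable_of_hasCompactSupport (radial_cs' h0 hr)

lemma radial_scale' {d : ℕ} (h : ℝ → ℝ) {r : ℝ} (hr : 0 < r) :
    ∫ x : Euc d, h (‖x‖ / r) = r ^ d * ∫ x : Euc d, h ‖x‖ := by
  have := Measure.integral_comp_smul (volume : Measure (Euc d)) (fun x => h ‖x‖) r⁻¹
  simp only [norm_smul, norm_inv, Real.norm_of_nonneg hr.le] at this
  rw [show (fun x : Euc d => h (‖x‖ / r)) = fun x => h (r⁻¹ * ‖x‖) by
    funext x; rw [div_eq_inv_mul], this]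
  simp [abs_of_pos hr]

lemma radial_div' {d : ℕ} (hd : 1 ≤ d) {G : ℝ → ℝ} (hG : ContDiff ℝ 1 G) (h0 : ∀ t, 1 / 2 ≤ |t - 1| → G t = 0) :
    ∫ x : Euc d, (deriv G ‖x‖ + ((d : ℝ) - 1) * (G ‖x‖ * ‖x‖⁻¹)) = 0 := by
  have : Nonempty (Fin d) := ⟨⟨0, hd⟩⟩
  have : Nontrivial (Euc d) := inferInstance
  rw [integral_fun_norm_addHaar (volume : Measure (Euc d)) (fun t => deriv G t + ((d : ℝ) - 1) * (G t * t⁻¹))]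
  have hcs : HasCompactSupport (fun t : ℝ => t ^ (d - 1) * G t) := by
    refine HasCompactSupport.mul_left (HasCompactSupport.intro (isCompact_Icc (a := (0:ℝ)) (b := 2)) fun x hx => h0 _ ?_)
    by_contra hh
    rw [not_le, abs_lt] at hh
    exact hx ⟨by linarith, by linarith⟩
  have h1 : _ = -((0 : ℝ) ^ (d - 1) * G 0) := hcs.integral_Ioi_deriv_eq ((contDiff_id.pow _).mul hG) 0
  have h2 : ∫ y in Set.Ioi (0:ℝ), y ^ (Module.finrank ℝ (Euc d) - 1) • (deriv G y + ((d : ℝ) - 1) * (G y * y⁻¹))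
      = ∫ y in Set.Ioi (0:ℝ), deriv (fun t : ℝ => t ^ (d - 1) * G t) y := by
    refine setIntegral_congr_fun measurableSet_Ioi fun y hy => ?_
    have hy : 0 < y := hy
    have := ((hasDerivAt_pow (d - 1) y).mul (hG.differentiable (by norm_num) y).hasDerivAt).deriv
    rw [show deriv (fun t : ℝ => t ^ (d - 1) * G t) y = _ from this]
    simp only [finrank_euclideanSpace, Fintype.card_fin, smul_eq_mul]
    obtain ⟨n, rfl⟩ : ∃ n, d = n + 1 := ⟨d - 1, by omega⟩
    simp only [Nat.add_sub_cancel, Nat.cast_add, Nat.cast_one]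
    cases n with
    | zero => simp
    | succ k => simp; field_simp; ring
  simp only [id] at h1
  rw [h2, h1, h0 0 (by norm_num)]
  simp

lemma abs_add_rpow' {x y q : ℝ} (hq : 0 ≤ q) : |x + y| ^ q ≤ 2 ^ q * (|x| ^ q + |y| ^ q) := by
  have h : |x + y| ≤ 2 * max |x| |y| := by
    have := abs_add_le x y
    linarith [le_max_left |x| |y|, le_max_right |x| |y|]
  calc |x + y| ^ q ≤ (2 * max |x| |y|) ^ q := by gcongr
    _ = 2 ^ q * (max |x| |y|) ^ q := by rw [Real.mul_rpow (by norm_num) (by positivity)]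
    _ ≤ _ := by
      gcongr
      have h1 : 0 ≤ |x| ^ q := by positivity
      have h2 : 0 ≤ |y| ^ q := by positivity
      rcases max_choice |x| |y| with h | h <;> rw [h] <;> linarith
set_option maxHeartbeats 2000000 in
lemma main_est' {d : ℕ} (hd : 1 ≤ d) {m ρ R a η q τ : ℝ} (hq : m.HolderConjugate q) (hρ : 0 < ρ) (hR : 0 < R)
    {b : Euc d → Euc d} {V α : Euc d → ℝ} (hH1 : HypH1 0 ρ R a η b V α) (hη : 1 < η)
    (ha : a < (d : ℝ) - 1) (hτ : 0 < τ) (hτ2 : τ < 1 / 2) :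
    ∃ K1 : ℝ, 0 ≤ K1 ∧ ∀ ε : ℝ, 0 < ε → ∃ K2 : ℝ, ∀ r β lam : ℝ, ∀ φ : Euc d → ℝ,
      R ≤ r * (1 - τ) → 0 ≤ β → IsSubsol m b V β lam φ →
      r * (lam - ρ ^ q / q) ≤ - (ρ ^ (q - 1) * ((d : ℝ) - 1 - a)) / (1 + τ)
        + β * r ^ (1 - η) * (1 - τ) ^ (-η) + ε * K1 + K2 * r ^ (1 - q) := by
  obtain ⟨⟨-, -, -, -, hbx, -, -, -, -⟩, hH⟩ := hH1
  have hq1 : 1 < q := hq.symm.lt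
  obtain ⟨G, E, hG, hG0, hGs, hG1, hE, hE0, hEs, hGd, hGE⟩ := profile' hτ hq1
  have hGc := hG.continuous
  have hG'c : Continuous (deriv G) := hG.continuous_deriv (by norm_num)
  have hG's : ∀ t, τ ≤ |t - 1| → deriv G t = 0 := fun t ht => hGd t (hGs t ht)
  have h2s : ∀ t : ℝ, 2 ≤ t → τ ≤ |t - 1| := fun t ht => by
    rw [abs_of_nonneg (by linarith)]; linarith
  -- the profiles
  set D : ℝ → ℝ := fun t => deriv G t + ((d : ℝ) - 1) * (G t * t⁻¹) with hD
  set E1 : ℝ → ℝ := fun t => 2 * |a| * G t + |deriv G t| with hE1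
  set E2 : ℝ → ℝ := fun t => 2 ^ q * ((2 * |a|) ^ q * G t + E t) with hE2
  have hDs : ∀ t, τ ≤ |t - 1| → D t = 0 := fun t ht => by simp [hD, hGs t ht, hG's t ht]
  have hE1s : ∀ t, τ ≤ |t - 1| → E1 t = 0 := fun t ht => by simp [hE1, hGs t ht, hG's t ht]
  have hE2s : ∀ t, τ ≤ |t - 1| → E2 t = 0 := fun t ht => by simp [hE2, hGs t ht, hEs t ht]
  have hDc : Continuous D := by
    refine hG'c.add (continuous_const.mul ?_)
    rw [continuous_iff_continuousAt]
    intro t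
    by_cases ht : t = 0
    · subst ht
      have e : (fun t => G t * t⁻¹) =ᶠ[nhds 0] fun _ => 0 := by
        filter_upwards [Metric.ball_mem_nhds (0 : ℝ) (by norm_num : (0:ℝ) < 1 / 2)] with y hy
        rw [mem_ball_zero_iff, Real.norm_eq_abs, abs_lt] at hy
        rw [hGs y, zero_mul]
        rw [abs_of_nonpos (by linarith)]; linarith
      exact continuousAt_const.congr e.symm
    · exact hGc.continuousAt.mul (continuousAt_inv₀ ht)
  have hE1c : Continuous E1 := (continuous_const.mul hGc).add hG'c.abs
  have hE2c : Continuous E2 := continuous_const.mul ((continuous_const.mul hGc).add hE)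
  have hE10 : ∀ t, 0 ≤ E1 t := fun t => by have := hG0 t; simp only [hE1]; positivity
  have hE20 : ∀ t, 0 ≤ E2 t := fun t => by have := hG0 t; have := hE0 t; simp only [hE2]; positivity
  have intg : ∀ h : ℝ → ℝ, Continuous h → (∀ t, τ ≤ |t - 1| → h t = 0) →
      Integrable (fun x : Euc d => h ‖x‖) := fun h hc hs => by
    simpa using radial_int' (d := d) hc (fun t ht => hs t (h2s t ht)) one_pos
  have iG := intg G hGc hGs
  have iD := intg D hDc hDs
  have i1 := intg E1 hE1c hE1s
  have i2 := intg E2 hE2c hE2s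
  set M := ∫ x : Euc d, G ‖x‖ with hM
  have hMpos : 0 < M := by
    have : Nonempty (Fin d) := ⟨⟨0, hd⟩⟩
    obtain ⟨x1, hx1⟩ := exists_norm_eq (Euc d) (zero_le_one (α := ℝ))
    refine Continuous.integral_pos_of_hasCompactSupport_nonneg_nonzero (x := x1)
      (hGc.comp continuous_norm) ?_ (fun x => hG0 _) ?_
    · have := radial_cs' (d := d) (h := G) (fun t ht => hGs t (h2s t ht)) one_pos
      simpa using this
    · simp only [hx1]; exact hG1.ne'
  have hDint : ∫ x : Euc d, D ‖x‖ = 0 := radial_div' hd hG fun t ht => hGs t (by linarith)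
  refine ⟨(∫ x : Euc d, E1 ‖x‖) / M, div_nonneg (integral_nonneg fun x => hE10 _) hMpos.le, fun ε hε => ?_⟩
  obtain ⟨C, hC0, hC⟩ := taylor' hρ hq1 hε
  refine ⟨C * ((∫ x : Euc d, E2 ‖x‖) / M), fun r β lam φ hr hβ hsub => ?_⟩
  obtain ⟨hφ, hφx⟩ := hsub
  have hr0 : 0 < r := by
    by_contra hh
    nlinarith
  set κ := ρ ^ (q - 1) with hκ
  have hκ0 : 0 < κ := by positivity
  set c0 := ρ ^ q / q - κ * ((d : ℝ) - 1 - a) / (r * (1 + τ)) + β * (r ^ (-η) * (1 - τ) ^ (-η)) with hc0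
  set F : ℝ → ℝ := fun t => (lam - c0) * G t - κ / r * D t - ε / r * E1 t - C * r ^ (-q) * E2 t with hF
  have hFc : Continuous F :=
    (((continuous_const.mul hGc).sub (continuous_const.mul hDc)).sub (continuous_const.mul hE1c)).sub
      (continuous_const.mul hE2c)
  have hFs : ∀ t, τ ≤ |t - 1| → F t = 0 := fun t ht => by
    simp [hF, hGs t ht, hDs t ht, hE1s t ht, hE2s t ht]
  set μ : Euc d → ℝ := fun x => G (‖x‖ / r) with hμ
  have hμcs : HasCompactSupport μ := radial_cs' (fun t ht => hGs t (h2s t ht)) hr0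
  have hμs : ContDiff ℝ 1 μ := by
    rw [contDiff_iff_contDiffAt]
    intro x
    by_cases hx : x = 0
    · subst hx
      have e : μ =ᶠ[nhds 0] fun _ => 0 := by
        filter_upwards [Metric.ball_mem_nhds (0 : Euc d) (by positivity : 0 < r / 2)] with y hy
        rw [mem_ball_zero_iff] at hy
        have h1 : ‖y‖ / r < 1 / 2 := by rw [div_lt_iff₀ hr0]; linarith
        refine hGs _ ?_
        rw [abs_of_nonpos (by linarith)]; linarith
      exact contDiffAt_const.congr_of_eventuallyEq e
    · exact hG.contDiffAt.comp x ((contDiffAt_norm ℝ hx).div_const r)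
  have hμg : ∀ x : Euc d, x ≠ 0 → gradient μ x = (deriv G (‖x‖ / r) / r * ‖x‖⁻¹) • x := by
    intro x hx
    apply HasGradientAt.gradient
    rw [hasGradientAt_iff_hasFDerivAt]
    have h1 := (hasGradientAt_iff_hasFDerivAt.1 (hasGradientAt_norm' hx)).mul_const r⁻¹
    have h2 := (hG.differentiable (by norm_num) (‖x‖ * r⁻¹)).hasDerivAt.comp_hasFDerivAt x h1
    have e : μ = G ∘ fun y : Euc d => ‖y‖ * r⁻¹ := by
      funext y; simp [hμ, div_eq_mul_inv]
    rw [e]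
    refine h2.congr_fderiv ?_
    ext v
    simp [div_eq_mul_inv]
    ring
  obtain ⟨hint, hint0⟩ := integral_by_parts' hφ hμs hμcs
  have hpt : ∀ x : Euc d, F (‖x‖ / r) ≤ μ x * lap φ x + ⟪gradient φ x, gradient μ x⟫ := by
    intro x
    set t := ‖x‖ / r with ht
    rcases (hG0 t).eq_or_lt with h0 | h0
    · have hμ0 : μ x = 0 := h0.symm
      have hg0 : gradient μ x = 0 := by
        have : IsLocalMin μ x := Eventually.of_forall fun y => by rw [hμ0]; exact hG0 _
        unfold gradient
        rw [this.fderiv_eq_zero, map_zero]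
      rw [hμ0, hg0, inner_zero_right, zero_mul, add_zero]
      have hD0 : D t = 0 := by simp [hD, ← h0, hGd t h0.symm]
      simp only [hF, ← h0, hD0, mul_zero]
      have := hE10 t; have := hE20 t
      have : 0 ≤ ε / r * E1 t := by positivity
      have : 0 ≤ C * r ^ (-q) * E2 t := by positivity
      linarith
    · have hlt : |t - 1| < τ := by
        by_contra hh
        rw [hGs t (not_lt.1 hh)] at h0
        exact lt_irrefl _ h0
      rw [abs_lt] at hlt
      have ht0 : 0 < t := by linarith
      have hxr : ‖x‖ = r * t := by rw [ht]; field_simp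
      have hxn : 0 < ‖x‖ := by rw [hxr]; positivity
      have hx0 : x ≠ 0 := norm_pos_iff.1 hxn
      have hRx : R ≤ ‖x‖ := by
        rw [hxr]
        have : r * (1 - τ) ≤ r * t := by gcongr; linarith
        linarith
      obtain ⟨hα, hVx⟩ := hH x hRx
      set s := (a / t + deriv G t / G t) / r with hs
      have hbn : ‖b x + (G t)⁻¹ • gradient μ x‖ = |ρ + s| := by
        have : b x + (G t)⁻¹ • gradient μ x = ((ρ + s) * ‖x‖⁻¹) • x := by
          rw [hμg x hx0, hbx x hRx, hα, ← ht, smul_smul, ← add_smul,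
            show (0 : ℝ) - 1 = -1 by norm_num, Real.rpow_neg_one, hs, hxr]
          congr 1
          field_simp
          ring
        rw [this, norm_smul, norm_mul, norm_inv, norm_norm, Real.norm_eq_abs]
        field_simp
      have hy := young' hq (gradient φ x) (gradient μ x) (b x) h0
      rw [hbn] at hy
      have hy2 := mul_le_mul_of_nonneg_left (hC s) h0.le
      have hsx := mul_le_mul_of_nonneg_left (hφx x) h0.le
      rw [hVx] at hsx
      -- individual bounds
      have b1 : G t * (κ * s) ≤ κ / r * D t - κ * ((d : ℝ) - 1 - a) / (r * (1 + τ)) * G t := by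
        have e : G t * (κ * s) = κ / r * D t - κ * ((d : ℝ) - 1 - a) / (r * t) * G t := by
          rw [hs, hD]; field_simp; ring
        rw [e]
        have : κ * ((d : ℝ) - 1 - a) / (r * (1 + τ)) ≤ κ * ((d : ℝ) - 1 - a) / (r * t) := by
          have : 0 < (d : ℝ) - 1 - a := by linarith
          gcongr
          linarith
        have := mul_le_mul_of_nonneg_right this h0.le
        linarith
      have hat : |a / t| ≤ 2 * |a| := by
        rw [abs_div, abs_of_pos ht0, div_le_iff₀ ht0]
        nlinarith [abs_nonneg a]
      have b2 : G t * (ε * |s|) ≤ ε / r * E1 t := by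
        have h1 : G t * |a / t + deriv G t / G t| ≤ E1 t := by
          calc G t * |a / t + deriv G t / G t| ≤ G t * (|a / t| + |deriv G t / G t|) := by
                gcongr; exact abs_add_le _ _
            _ ≤ G t * (2 * |a| + |deriv G t / G t|) := by gcongr
            _ = E1 t := by rw [abs_div, abs_of_pos h0, hE1]; field_simp
        rw [hs, abs_div, abs_of_pos hr0]
        calc G t * (ε * (|a / t + deriv G t / G t| / r)) = ε / r * (G t * |a / t + deriv G t / G t|) := by ring
          _ ≤ _ := by gcongr
      have b3 : G t * (C * |s| ^ q) ≤ C * r ^ (-q) * E2 t := by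
        have h1 : G t * |a / t + deriv G t / G t| ^ q ≤ E2 t := by
          calc G t * |a / t + deriv G t / G t| ^ q
              ≤ G t * (2 ^ q * (|a / t| ^ q + |deriv G t / G t| ^ q)) := by
                gcongr; exact abs_add_rpow' (by linarith)
            _ ≤ G t * (2 ^ q * ((2 * |a|) ^ q + |deriv G t / G t| ^ q)) := by gcongr
            _ = 2 ^ q * ((2 * |a|) ^ q * G t + G t * |deriv G t / G t| ^ q) := by ring
            _ ≤ E2 t := by
                simp only [hE2]; gcongr; exact hGE t h0
        rw [hs, abs_div, abs_of_pos hr0, Real.div_rpow (abs_nonneg _) hr0.le, Real.rpow_neg hr0.le]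
        calc G t * (C * (|a / t + deriv G t / G t| ^ q / r ^ q))
            = C * (r ^ q)⁻¹ * (G t * |a / t + deriv G t / G t| ^ q) := by ring
          _ ≤ _ := by gcongr
      have b4 : G t * (β * ‖x‖ ^ (-η)) ≤ β * (r ^ (-η) * (1 - τ) ^ (-η)) * G t := by
        rw [hxr, Real.mul_rpow hr0.le ht0.le]
        have : t ^ (-η) ≤ (1 - τ) ^ (-η) :=
          Real.rpow_le_rpow_of_nonpos (by linarith) (by linarith) (by linarith)
        calc G t * (β * (r ^ (-η) * t ^ (-η))) = β * (r ^ (-η) * t ^ (-η)) * G t := by ring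
          _ ≤ _ := by gcongr
      have hμt : μ x = G t := rfl
      rw [hμt]
      simp only [hF, hc0]
      linarith [hy, hy2, hsx, b1, b2, b3, b4]
  have hle : ∫ x : Euc d, F (‖x‖ / r) ≤ 0 := by
    rw [← hint0]
    exact integral_mono (radial_int' hFc (fun t ht => hFs t (h2s t ht)) hr0) hint hpt
  rw [radial_scale' F hr0] at hle
  have hle2 : ∫ x : Euc d, F ‖x‖ ≤ 0 := by
    by_contra hh
    have : 0 < r ^ d * ∫ x : Euc d, F ‖x‖ := mul_pos (by positivity) (not_le.1 hh)
    linarith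
  have hFint : ∫ x : Euc d, F ‖x‖ = (lam - c0) * M - κ / r * 0 - ε / r * (∫ x : Euc d, E1 ‖x‖)
      - C * r ^ (-q) * ∫ x : Euc d, E2 ‖x‖ := by
    simp only [hF]
    rw [integral_sub, integral_sub, integral_sub, integral_const_mul, integral_const_mul,
      integral_const_mul, integral_const_mul, hDint]
    · exact iG.const_mul _
    · exact iD.const_mul _
    · exact (iG.const_mul _).sub (iD.const_mul _)
    · exact i1.const_mul _
    · exact ((iG.const_mul _).sub (iD.const_mul _)).sub (i1.const_mul _)
    · exact i2.const_mul _
  rw [hFint] at hle2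
  set I1 := ∫ x : Euc d, E1 ‖x‖
  set I2 := ∫ x : Euc d, E2 ‖x‖
  have hfin : (lam - c0) ≤ ε / r * (I1 / M) + C * r ^ (-q) * (I2 / M) := by
    have : (ε / r * (I1 / M) + C * r ^ (-q) * (I2 / M)) = (ε / r * I1 + C * r ^ (-q) * I2) / M := by ring
    rw [this, le_div_iff₀ hMpos]; linarith
  have hfin2 := mul_le_mul_of_nonneg_left hfin hr0.le
  have e1 : r * r ^ (-q) = r ^ (1 - q) := by
    rw [show 1 - q = 1 + -q by ring, Real.rpow_add hr0, Real.rpow_one]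
  have e2 : r * r ^ (-η) = r ^ (1 - η) := by
    rw [show 1 - η = 1 + -η by ring, Real.rpow_add hr0, Real.rpow_one]
  rw [← e1, ← e2]
  have e3 : r * (lam - c0) = r * (lam - ρ ^ q / q) + κ * ((d : ℝ) - 1 - a) / (1 + τ)
      - β * (r * r ^ (-η)) * (1 - τ) ^ (-η) := by
    have : r * (κ * ((d : ℝ) - 1 - a) / (r * (1 + τ))) = κ * ((d : ℝ) - 1 - a) / (1 + τ) := by
      field_simp
    rw [← this, hc0]; ring
  have e4 : r * (ε / r * (I1 / M) + C * r ^ (-q) * (I2 / M)) = ε * (I1 / M) + C * (I2 / M) * (r * r ^ (-q)) := by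
    field_simp
  rw [e3, e4] at hfin2
  rw [neg_div]
  linarith
lemma lower' {d : ℕ} (hd : 1 ≤ d) {m ρ R a η q : ℝ} (hq : m.HolderConjugate q) (hρ : 0 < ρ) (hR : 0 < R)
    {b : Euc d → Euc d} {V α : Euc d → ℝ} (hH1 : HypH1 0 ρ R a η b V α) (hη : 1 < η)
    (ha : a < (d : ℝ) - 1) {A : ℝ} (hA : A = ρ ^ (q - 1) * ((d : ℝ) - 1 - a)) {c : ℝ} (hc : c < A - A / η) :
    ∀ᶠ r : ℝ in atTop, ∀ (lam : ℝ) (φ : Euc d → ℝ), IsSubsol m b V (r ^ (η - 1) * (A / η)) lam φ →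
      c ≤ r * (ρ ^ q / q - lam) := by
  have hA0 : 0 < A := by rw [hA]; exact mul_pos (by positivity) (by linarith)
  obtain ⟨c', hcc', hc'⟩ := exists_between hc
  have hcont : ContinuousAt (fun τ : ℝ => A / (1 + τ) - A / η * (1 - τ) ^ (-η)) 0 := by
    refine ContinuousAt.sub (ContinuousAt.div continuousAt_const (by fun_prop) (by norm_num)) ?_
    exact continuousAt_const.mul (ContinuousAt.rpow_const (by fun_prop) (Or.inl (by norm_num)))
  have h1 : ∀ᶠ τ : ℝ in nhdsWithin 0 (Set.Ioi 0), c' < A / (1 + τ) - A / η * (1 - τ) ^ (-η) := by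
    refine (hcont.eventually (lt_mem_nhds ?_)).filter_mono nhdsWithin_le_nhds
    simpa using hc'
  have h2 : ∀ᶠ τ : ℝ in nhdsWithin 0 (Set.Ioi 0), τ < 1 / 2 :=
    (gt_mem_nhds (by norm_num : (0 : ℝ) < 1 / 2)).filter_mono nhdsWithin_le_nhds
  obtain ⟨τ, ⟨h3, h4⟩, h5⟩ := ((h1.and h2).and self_mem_nhdsWithin).exists
  have h5 : 0 < τ := h5
  obtain ⟨K1, hK1, h6⟩ := main_est' hd hq hρ hR hH1 hη ha h5 h4
  obtain ⟨K2, h7⟩ := h6 ((c' - c) / (2 * (K1 + 1))) (div_pos (by linarith) (by positivity))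
  have hq1 : 1 < q := hq.symm.lt
  have h8 : Tendsto (fun r : ℝ => K2 * r ^ (1 - q)) atTop (nhds (K2 * 0)) := by
    have := tendsto_rpow_neg_atTop (y := q - 1) (by linarith)
    rw [show -(q - 1) = 1 - q by ring] at this
    exact this.const_mul K2
  rw [mul_zero] at h8
  have h9 : ∀ᶠ r : ℝ in atTop, K2 * r ^ (1 - q) < (c' - c) / 2 := h8.eventually (gt_mem_nhds (by linarith))
  filter_upwards [h9, eventually_ge_atTop (R / (1 - τ)), eventually_gt_atTop 0] with r hr hrR hr0 lam φ hsub
  rw [div_le_iff₀ (by linarith)] at hrR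
  have h10 := h7 r _ lam φ hrR (by positivity) hsub
  rw [← hA] at h10
  have e1 : r ^ (η - 1) * (A / η) * r ^ (1 - η) = A / η := by
    have : r ^ (η - 1) * r ^ (1 - η) = 1 := by rw [← Real.rpow_add hr0]; simp
    linear_combination (A / η) * this
  rw [e1, neg_div] at h10
  have e2 : (c' - c) / (2 * (K1 + 1)) * K1 ≤ (c' - c) / 2 := by
    rw [div_mul_eq_mul_div, div_le_div_iff₀ (by positivity) (by norm_num)]
    nlinarith
  linarith

/-- lower estimate for `ρ^{m*}/m* - λ_max(β)` in the moderate drift case. -/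
theorem stmt18 (d : ℕ) (hd : 1 ≤ d) (m ρ R a η : ℝ) (hm : 1 < m)
    (hρ : 0 < ρ) (hη : 0 < η) (hR : 0 < R)
    (mst : ℝ) (hmst : mst = m / (m - 1))
    (b : Euc d → Euc d) (V : Euc d → ℝ) (α : Euc d → ℝ)
    (hH1 : HypH1 0 ρ R a η b V α)
    (hη1 : 1 < η) (ha : a < (d : ℝ) - 1)
    (c₁ : ℝ) (hc₁ : c₁ = (η - 1) * (ρ ^ (mst - 1) * ((d : ℝ) - 1 - a) / η) ^ (η / (η - 1))) :
    c₁ ≤ Filter.liminf (fun β : ℝ => β ^ (1 / (η - 1)) * (ρ ^ mst / mst - lamMax m b V β))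
      atTop := by
  have hq : m.HolderConjugate mst := by
    rw [hmst]; exact Real.HolderConjugate.conjExponent hm
  set A := ρ ^ (mst - 1) * ((d : ℝ) - 1 - a) with hA
  have hA0 : 0 < A := mul_pos (by positivity) (by linarith)
  have h1 : 0 < η - 1 := by linarith
  set t0 := (η / A) ^ (1 / (η - 1)) with ht0
  have ht00 : 0 < t0 := by positivity
  have hct : c₁ * t0 = A - A / η := by
    have e : (A / η) ^ (η / (η - 1)) = (A / η) * (A / η) ^ (1 / (η - 1)) := by
      nth_rewrite 2 [← Real.rpow_one (A / η)]
      rw [← Real.rpow_add (by positivity)]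
      congr 1; field_simp; ring
    have e2 : (A / η) ^ (1 / (η - 1)) * t0 = 1 := by
      rw [ht0, ← Real.mul_rpow (by positivity) (by positivity),
        show A / η * (η / A) = 1 by field_simp, Real.one_rpow]
    rw [hc₁, e]
    have : (η - 1) * (A / η) = A - A / η := by field_simp
    linear_combination (η - 1) * (A / η) * e2 + this
  have htend : Tendsto (fun β : ℝ => t0 * β ^ (1 / (η - 1))) atTop atTop :=
    (tendsto_rpow_atTop (by positivity)).const_mul_atTop ht00
  have hbeta : ∀ β : ℝ, 0 < β → (t0 * β ^ (1 / (η - 1))) ^ (η - 1) * (A / η) = β := by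
    intro β hβ
    rw [Real.mul_rpow ht00.le (by positivity), ht0, ← Real.rpow_mul (by positivity),
      ← Real.rpow_mul hβ.le, one_div_mul_cancel h1.ne', Real.rpow_one, Real.rpow_one]
    field_simp
  have hsubs : ∀ c : ℝ, c < c₁ → ∀ᶠ β : ℝ in atTop, ∀ lam ∈ {lam : ℝ | ∃ φ : Euc d → ℝ, IsSubsol m b V β lam φ},
      lam ≤ ρ ^ mst / mst - c / β ^ (1 / (η - 1)) := by
    intro c hc
    have hc' : c * t0 < A - A / η := by rw [← hct]; gcongr
    filter_upwards [htend.eventually (lower' hd hq hρ hR hH1 hη1 ha hA hc'), eventually_gt_atTop 0]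
      with β hβ hβ0 lam hlam
    obtain ⟨φ, hφ⟩ := hlam
    rw [hbeta β hβ0] at hβ
    have h2 := hβ lam φ hφ
    have hp : 0 < β ^ (1 / (η - 1)) := by positivity
    have h3 : c ≤ (ρ ^ mst / mst - lam) * β ^ (1 / (η - 1)) := by
      refine le_of_mul_le_mul_right ?_ ht00
      linarith
    rw [← div_le_iff₀ hp] at h3
    linarith
  obtain ⟨C, hC⟩ := exists_subsol' hq hρ hR hH1 hη1 ha
  have hcob : IsBoundedUnder (· ≤ ·) atTop
      (fun β : ℝ => β ^ (1 / (η - 1)) * (ρ ^ mst / mst - lamMax m b V β)) := by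
    refine ⟨C, ?_⟩
    rw [eventually_map]
    filter_upwards [hC, hsubs (c₁ - 1) (by linarith), eventually_gt_atTop 0] with β hβ hs hβ0
    have hp : 0 < β ^ (1 / (η - 1)) := by positivity
    have h2 : ρ ^ mst / mst - C * β ^ (-(1 / (η - 1))) ≤ lamMax m b V β := le_csSup ⟨_, hs⟩ hβ
    rw [Real.rpow_neg hβ0.le] at h2
    have h3 : ρ ^ mst / mst - lamMax m b V β ≤ C * (β ^ (1 / (η - 1)))⁻¹ := by linarith
    calc β ^ (1 / (η - 1)) * (ρ ^ mst / mst - lamMax m b V β)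
        ≤ β ^ (1 / (η - 1)) * (C * (β ^ (1 / (η - 1)))⁻¹) := by gcongr
      _ = C := by field_simp
  refine le_of_forall_lt_imp_le_of_dense fun c hc => ?_
  refine le_liminf_of_le hcob.isCoboundedUnder_ge ?_
  filter_upwards [hC, hsubs c hc, eventually_gt_atTop 0] with β hβ hs hβ0
  have hp : 0 < β ^ (1 / (η - 1)) := by positivity
  have h2 : lamMax m b V β ≤ ρ ^ mst / mst - c / β ^ (1 / (η - 1)) := csSup_le ⟨_, hβ⟩ hs
  have h3 : c / β ^ (1 / (η - 1)) ≤ ρ ^ mst / mst - lamMax m b V β := by linarith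
  rw [div_le_iff₀ hp] at h3
  linarith

end
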